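/- Let x_1 < ⋯ < x_n be real points with δ = min_{i≠j} |x_i − x_j| > 0, let σ² > 0, ℓ² > 0, σ_n² > 0, and let K_θ be the squared-exponential Gram matrix. Suppose k ≤ n is chosen such that there exists ε with (K_θ)_{ij} ≤ ε for all |i−j| > k and ε ≤ (3σ_n²δ²)/(4ℓ²)·exp(−3δ²/(2ℓ²)). Then the symmetric matrix L_k(K_θ) + σ_n² I − K_θ is positive definite; in particular L_k(K_θ) + σ_n² I ≻ K_θ in the Loewner order. -/

import Mathlib

open Matrix BigOperators

/-- The cut-off operator `L_k`: keeps entries within bandwidth `k`, zeroes the rest. -/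
def cutoff {n : ℕ} (k : ℕ) (A : Matrix (Fin n) (Fin n) ℝ) :
    Matrix (Fin n) (Fin n) ℝ :=
  Matrix.of fun i j => if |(i : ℤ) - (j : ℤ)| ≤ (k : ℤ) then A i j else 0

/-- The squared-exponential Gram matrix `(K_θ)_{ij} = σ² exp(−(x_i−x_j)²/(2ℓ²))`. -/
noncomputable def seGram {n : ℕ} (x : Fin n → ℝ) (σ2 l2 : ℝ) :
    Matrix (Fin n) (Fin n) ℝ :=
  Matrix.of fun i j => σ2 * Real.exp (-(x i - x j) ^ 2 / (2 * l2))

/-- A nonnegative symmetric matrix with all row sums below `c` is dominated by `c • 1`. -/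
theorem Matrix.PosDef.smul_one_sub_of_sum_lt {ι : Type*} [Fintype ι] [DecidableEq ι]
    {R : Matrix ι ι ℝ} {c : ℝ} (hsymm : R.IsSymm) (hnonneg : ∀ i j, 0 ≤ R i j)
    (hsum : ∀ i, ∑ j, R i j < c) : (c • (1 : Matrix ι ι ℝ) - R).PosDef := by
  refine Matrix.PosDef.of_dotProduct_mulVec_pos ?_ fun v hv => ?_
  · rw [Matrix.IsHermitian, Matrix.conjTranspose_eq_transpose_of_trivial, Matrix.transpose_sub,
      Matrix.transpose_smul, Matrix.transpose_one, hsymm.eq]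
  have hquad : ∑ i, ∑ j, v i * (R i j * v j) ≤ ∑ i, (∑ j, R i j) * v i ^ 2 := by
    have hswap : ∑ i, ∑ j, R i j * v j ^ 2 = ∑ i, ∑ j, R i j * v i ^ 2 := by
      rw [Finset.sum_comm]
      exact Finset.sum_congr rfl fun i _ => Finset.sum_congr rfl fun j _ => by
        rw [hsymm.apply]
    have hamgm : ∑ i, ∑ j, v i * (R i j * v j) ≤
        ∑ i, ∑ j, (R i j * v i ^ 2 / 2 + R i j * v j ^ 2 / 2) :=
      Finset.sum_le_sum fun i _ => Finset.sum_le_sum fun j _ => by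
        nlinarith [mul_nonneg (hnonneg i j) (sq_nonneg (v i - v j))]
    simp only [Finset.sum_add_distrib, ← Finset.sum_div, hswap, add_halves] at hamgm
    simpa only [Finset.sum_mul] using hamgm
  have hlt : ∑ i, (∑ j, R i j) * v i ^ 2 < ∑ i, c * v i ^ 2 := by
    obtain ⟨i, hi⟩ := Function.ne_iff.mp hv
    exact Finset.sum_lt_sum (fun j _ => mul_le_mul_of_nonneg_right (hsum j).le (sq_nonneg _))
      ⟨i, Finset.mem_univ i, mul_lt_mul_of_pos_right (hsum i) (sq_pos_of_ne_zero hi)⟩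
  have hform : star v ⬝ᵥ ((c • (1 : Matrix ι ι ℝ) - R) *ᵥ v) =
      ∑ i, c * v i ^ 2 - ∑ i, ∑ j, v i * (R i j * v j) := by
    rw [Matrix.sub_mulVec, Matrix.smul_mulVec, Matrix.one_mulVec, dotProduct_sub]
    simp only [dotProduct, Matrix.mulVec, Finset.mul_sum, star_trivial, Pi.smul_apply, smul_eq_mul]
    congr 1
    exact Finset.sum_congr rfl fun i _ => by ring
  rw [hform]
  linarith

theorem sum_pow_le_of_injOn {ι : Type*} {s : Finset ι} {f : ι → ℕ} (hf : Set.InjOn f s)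
    {r : ℝ} (hr0 : 0 ≤ r) (hr1 : r < 1) : ∑ j ∈ s, r ^ f j ≤ (1 - r)⁻¹ := by
  rw [← Finset.sum_image (f := fun m => r ^ m) hf, ← tsum_geometric_of_lt_one hr0 hr1]
  exact (summable_geometric_of_lt_one hr0 hr1).sum_le_tsum _ fun m _ => pow_nonneg hr0 m

theorem seGram_comm {n : ℕ} (x : Fin n → ℝ) (σ2 l2 : ℝ) (i j : Fin n) :
    seGram x σ2 l2 i j = seGram x σ2 l2 j i := by
  simp only [seGram, Matrix.of_apply]
  rw [← neg_sub, neg_sq]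

theorem nsmul_gap_le_sub {n : ℕ} {x : Fin n → ℝ} {δ : ℝ}
    (hgap : ∀ i j : Fin n, i < j → δ ≤ x j - x i) (m : ℕ) (i j : Fin n)
    (hij : (j : ℕ) = i + m) : m * δ ≤ x j - x i := by
  induction m generalizing j with
  | zero =>
    obtain rfl : j = i := Fin.ext hij
    simp
  | succ m ih =>
    have hlast := hgap ⟨i + m, by omega⟩ j (Fin.lt_def.mpr (by simp; omega))
    have hinit := ih ⟨i + m, by omega⟩ rfl
    push_cast
    linarith

theorem seGram_le_mul_pow {n k s : ℕ} {x : Fin n → ℝ} {σ2 l2 δ B : ℝ}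
    (hσ2 : 0 < σ2) (hl2 : 0 < l2) (hδ : 0 < δ)
    (hgap : ∀ i j : Fin n, i < j → δ ≤ x j - x i)
    (hB : ∀ i j : Fin n, (k : ℤ) < |(i : ℤ) - (j : ℤ)| → seGram x σ2 l2 i j ≤ B)
    {i j : Fin n} (hij : (j : ℕ) = i + (k + 1) + s) :
    seGram x σ2 l2 i j ≤ B * Real.exp (-(3 * δ ^ 2) / (2 * l2)) ^ s := by
  let p : Fin n := ⟨i + (k + 1), by omega⟩
  have hp : (p : ℕ) = i + (k + 1) := rfl
  have ha : δ ≤ x p - x i := hgap i p (Fin.lt_def.mpr (by omega))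
  have hb : s * δ ≤ x j - x p := nsmul_gap_le_sub hgap s p j hij
  have hBp : seGram x σ2 l2 i p ≤ B :=
    hB i p (by rw [hp, abs_sub_comm, lt_abs]; left; push_cast; omega)
  have hs : (s : ℝ) ≤ (s : ℝ) ^ 2 := by exact_mod_cast Nat.le_self_pow two_ne_zero s
  have hs0 : (0 : ℝ) ≤ s := s.cast_nonneg
  have hsq : (x i - x p) ^ 2 + s * (3 * δ ^ 2) ≤ (x i - x j) ^ 2 := by
    have hcross : δ * (s * δ) ≤ (x p - x i) * (x j - x p) :=
      mul_le_mul ha hb (by positivity) (by linarith)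
    have hfar : (s * δ) ^ 2 ≤ (x j - x p) ^ 2 := pow_le_pow_left₀ (by positivity) hb 2
    nlinarith [mul_le_mul_of_nonneg_right hs (sq_nonneg δ)]
  calc seGram x σ2 l2 i j
      ≤ σ2 * Real.exp (-(x i - x p) ^ 2 / (2 * l2) + s * (-(3 * δ ^ 2) / (2 * l2))) := by
        simp only [seGram, Matrix.of_apply]
        gcongr
        rw [← mul_div_assoc, ← add_div]
        gcongr
        linarith
    _ = seGram x σ2 l2 i p * Real.exp (-(3 * δ ^ 2) / (2 * l2)) ^ s := by
        simp only [seGram, Matrix.of_apply]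
        rw [Real.exp_add, Real.exp_nat_mul, mul_assoc]
    _ ≤ B * Real.exp (-(3 * δ ^ 2) / (2 * l2)) ^ s := by gcongr

theorem sum_off_band_le {n k : ℕ} {A : Matrix (Fin n) (Fin n) ℝ} {B r : ℝ}
    (hB : 0 ≤ B) (hr0 : 0 ≤ r) (hr1 : r < 1) (hsymm : A.IsSymm)
    (hA : ∀ (s : ℕ) (i j : Fin n), (j : ℕ) = i + (k + 1) + s → A i j ≤ B * r ^ s)
    (i : Fin n) : ∑ j, (A - cutoff k A) i j ≤ 2 * B * (1 - r)⁻¹ := by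
  let U : Finset (Fin n) := {j | (i : ℕ) + k < j}
  let D : Finset (Fin n) := {j | (j : ℕ) + k < i}
  have hU : ∑ j ∈ U, r ^ ((j : ℕ) - (i + (k + 1))) ≤ (1 - r)⁻¹ :=
    sum_pow_le_of_injOn (fun a ha b hb hab => Fin.ext (by simp [U] at ha hb hab; omega)) hr0 hr1
  have hD : ∑ j ∈ D, r ^ ((i : ℕ) - (j + (k + 1))) ≤ (1 - r)⁻¹ :=
    sum_pow_le_of_injOn (fun a ha b hb hab => Fin.ext (by simp [D] at ha hb hab; omega)) hr0 hr1
  have hentry (j : Fin n) : (A - cutoff k A) i j ≤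
      (if j ∈ U then B * r ^ ((j : ℕ) - (i + (k + 1))) else 0) +
        (if j ∈ D then B * r ^ ((i : ℕ) - (j + (k + 1))) else 0) := by
    simp only [Matrix.sub_apply, cutoff, Matrix.of_apply, U, D, Finset.mem_filter,
      Finset.mem_univ, true_and]
    rcases lt_or_ge ((i : ℕ) + k) j with h | h
    · rw [if_neg (by rw [abs_le]; omega), if_pos h, if_neg (by omega), sub_zero, add_zero]
      exact hA _ i j (by omega)
    rcases lt_or_ge ((j : ℕ) + k) i with h' | h'
    · rw [if_neg (by rw [abs_le]; omega), if_neg (by omega), if_pos h', sub_zero, zero_add,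
        ← hsymm.apply]
      exact hA _ j i (by omega)
    · rw [if_pos (by rw [abs_le]; omega), if_neg (by omega), if_neg (by omega), sub_self, add_zero]
  refine (Finset.sum_le_sum fun j _ => hentry j).trans ?_
  rw [Finset.sum_add_distrib, Finset.sum_ite_mem, Finset.sum_ite_mem, Finset.univ_inter,
    Finset.univ_inter, ← Finset.mul_sum, ← Finset.mul_sum]
  nlinarith [mul_le_mul_of_nonneg_left hU hB, mul_le_mul_of_nonneg_left hD hB]

theorem mul_exp_neg_mul_inv_lt_one {t : ℝ} (ht : 0 < t) :
    t * Real.exp (-t) * (1 - Real.exp (-t))⁻¹ < 1 := by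
  have hlt : Real.exp (-t) < 1 := Real.exp_lt_one_iff.mpr (by linarith)
  rw [← div_eq_mul_inv, div_lt_one (by linarith)]
  have hmul : (t + 1) * Real.exp (-t) < Real.exp t * Real.exp (-t) :=
    mul_lt_mul_of_pos_right (Real.add_one_lt_exp ht.ne') (Real.exp_pos _)
  rw [← Real.exp_add, add_neg_cancel, Real.exp_zero] at hmul
  linarith

/-- **Loewner domination.** Under the BTC bandwidth condition,
`L_k(K_θ) + σ_n² I − K_θ` is positive definite, i.e. `L_k(K_θ) + σ_n² I ≻ K_θ`. -/
theorem cutoff_add_noise_loewner_gt {n : ℕ} (k : ℕ) (hk : k ≤ n)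
    (x : Fin n → ℝ) (hx : StrictMono x)
    (σ2 l2 σn2 δ : ℝ) (hσ2 : 0 < σ2) (hl2 : 0 < l2) (hσn2 : 0 < σn2)
    (hδ : IsLeast {d : ℝ | ∃ i j : Fin n, i ≠ j ∧ d = |x i - x j|} δ) (hδ0 : 0 < δ)
    (ε : ℝ)
    (hε : ∀ i j : Fin n, (k : ℤ) < |(i : ℤ) - (j : ℤ)| → seGram x σ2 l2 i j ≤ ε)
    (hεbound : ε ≤ 3 * σn2 * δ ^ 2 / (4 * l2) * Real.exp (-(3 * δ ^ 2) / (2 * l2))) :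
    (cutoff k (seGram x σ2 l2) + σn2 • (1 : Matrix (Fin n) (Fin n) ℝ)
      - seGram x σ2 l2).PosDef := by
  have hgap (i j : Fin n) (hij : i < j) : δ ≤ x j - x i := by
    have hle := hδ.2 ⟨j, i, hij.ne', rfl⟩
    rwa [abs_of_pos (sub_pos.mpr (hx hij))] at hle
  set t : ℝ := 3 * δ ^ 2 / (2 * l2) with ht
  have ht0 : 0 < t := by positivity
  have hexp : -(3 * δ ^ 2) / (2 * l2) = -t := neg_div _ _
  have hcoef : 3 * σn2 * δ ^ 2 / (4 * l2) = σn2 * t / 2 := by rw [ht]; field_simp; ring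
  rw [hexp, hcoef] at hεbound
  have hsymm : (seGram x σ2 l2).IsSymm := Matrix.IsSymm.ext fun i j => seGram_comm x σ2 l2 j i
  have hsum (i : Fin n) :
      ∑ j, (seGram x σ2 l2 - cutoff k (seGram x σ2 l2)) i j < σn2 := by
    have hrow := sum_off_band_le (k := k) (A := seGram x σ2 l2)
      (B := σn2 * t / 2 * Real.exp (-t)) (by positivity) (Real.exp_pos (-t)).le
      (Real.exp_lt_one_iff.mpr (by linarith)) hsymm
      (fun s i j hij => hexp ▸ seGram_le_mul_pow hσ2 hl2 hδ0 hgap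
        (fun i j h => (hε i j h).trans hεbound) hij) i
    have hlt := mul_lt_mul_of_pos_left (mul_exp_neg_mul_inv_lt_one ht0) hσn2
    linarith
  have hpos := Matrix.PosDef.smul_one_sub_of_sum_lt (c := σn2)
    (R := seGram x σ2 l2 - cutoff k (seGram x σ2 l2))
    (Matrix.IsSymm.ext fun i j => by
      simp only [Matrix.sub_apply, cutoff, Matrix.of_apply, seGram_comm x σ2 l2 j i,
        abs_sub_comm (j : ℤ) i])
    (fun i j => by
      have h0 : 0 ≤ seGram x σ2 l2 i j := by simp only [seGram, Matrix.of_apply]; positivity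
      simp only [Matrix.sub_apply, cutoff, Matrix.of_apply]
      split_ifs <;> simp [h0])
    hsum
  rwa [sub_sub_eq_add_sub, add_comm] at hpos
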